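/- Let ℓ, ℓ̃ > 0 with ℓ ≠ ℓ̃, let b, b̃ > 0, and define f(x) := x + b(1+x)^{1+ℓ} and h(x) := x + b̃(1+x)^{1+ℓ̃}, and set r := min{ℓ, ℓ̃}. Then there exists a constant C > 0 such that for every x₁ ∈ (-1, 0), every x ∈ [-1, x₁] and every integer k with 1 ≤ k ≤ ⌈r⌉, the k-th derivatives satisfy |D^k f(x) - D^k h(x)| ≤ C·(1+x₁)^{1+r-k}. -/

import Mathlib

open Set

/-- The `k`-th derivative of a power perturbation of the identity, valid also at the endpoint
`x = -1` as long as `k ≤ p`. -/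
lemma iteratedDeriv_id_add_mul_one_add_rpow (b p x : ℝ) (k : ℕ) (hk : (k : ℝ) ≤ p) :
    iteratedDeriv k (fun y : ℝ => y + b * (1 + y) ^ p) x =
      iteratedDeriv k (fun y : ℝ => y) x +
        b * ((descPochhammer ℝ k).eval p * (1 + x) ^ (p - k)) := by
  have hpow : ContDiff ℝ k (fun y : ℝ => (1 + y) ^ p) :=
    (Real.contDiff_rpow_const_of_le hk).comp (contDiff_const.add contDiff_id)
  have hcomp := congrFun (iteratedDeriv_comp_const_add k (fun y : ℝ => y ^ p) 1) x
  rw [iteratedDeriv_fun_add contDiffAt_fun_id (contDiff_const.mul hpow).contDiffAt,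
    iteratedDeriv_const_mul_field, hcomp, iteratedDeriv_eq_iterate (f := fun y : ℝ => y ^ p),
    Real.iter_deriv_rpow_const]

/-- Powers with a larger exponent and a smaller base are smaller on `[0, 1]`. -/
lemma rpow_le_rpow_of_base_le_of_exponent_ge {s t p q : ℝ} (hs : 0 ≤ s) (hst : s ≤ t)
    (ht : 0 < t) (ht1 : t ≤ 1) (hq : 0 ≤ q) (hqp : q ≤ p) : s ^ p ≤ t ^ q :=
  (Real.rpow_le_rpow hs hst (hq.trans hqp)).trans (Real.rpow_le_rpow_of_exponent_ge ht ht1 hqp)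

/-- Let `ℓ, ℓ̃ > 0` with `ℓ ≠ ℓ̃`, `b, b̃ > 0`, and let
`f(x) = x + b(1+x)^{1+ℓ}`, `h(x) = x + b̃(1+x)^{1+ℓ̃}`, `r = min{ℓ, ℓ̃}`. Then there is a
constant `C > 0` such that for every `x₁ ∈ (-1,0)`, every `x ∈ [-1, x₁]` and every integer
`1 ≤ k ≤ ⌈r⌉`, `|D^k f(x) - D^k h(x)| ≤ C (1+x₁)^{1+r-k}`. -/
theorem normal_form_derivative_bounds
    (ℓ lt b bt : ℝ) (hℓ : 0 < ℓ) (hlt : 0 < lt) (hne : ℓ ≠ lt)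
    (hb : 0 < b) (hbt : 0 < bt) :
    ∃ C > (0 : ℝ), ∀ x₁ ∈ Ioo (-1 : ℝ) 0, ∀ x ∈ Icc (-1 : ℝ) x₁, ∀ k : ℕ,
      1 ≤ k → k ≤ Nat.ceil (min ℓ lt) →
      |iteratedDeriv k (fun y => y + b * (1 + y) ^ (1 + ℓ)) x -
          iteratedDeriv k (fun y => y + bt * (1 + y) ^ (1 + lt)) x|
        ≤ C * (1 + x₁) ^ (1 + min ℓ lt - (k : ℝ)) := by
  set r := min ℓ lt
  have hr0 : 0 < r := lt_min hℓ hlt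
  have hrℓ : r ≤ ℓ := min_le_left _ _
  have hrlt : r ≤ lt := min_le_right _ _
  let c : ℕ → ℝ := fun k =>
    |b * (descPochhammer ℝ k).eval (1 + ℓ)| + |bt * (descPochhammer ℝ k).eval (1 + lt)|
  have hc : ∀ k, 0 ≤ c k := fun k => by positivity
  have hsum : 0 ≤ ∑ k ∈ Finset.range (Nat.ceil r + 1), c k := Finset.sum_nonneg fun k _ => hc k
  refine ⟨1 + ∑ k ∈ Finset.range (Nat.ceil r + 1), c k, by linarith, ?_⟩
  rintro x₁ ⟨hx₁, hx₁'⟩ x ⟨hx, hxx₁⟩ k - hk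
  have hkr : (k : ℝ) < r + 1 :=
    (Nat.cast_le.mpr hk).trans_lt (Nat.ceil_lt_add_one hr0.le)
  have hck : c k ≤ 1 + ∑ k ∈ Finset.range (Nat.ceil r + 1), c k := by
    have := Finset.single_le_sum (fun k _ => hc k) (Finset.mem_range.mpr (Nat.lt_succ_of_le hk))
    linarith
  have hbound : ∀ p, r ≤ p → |(1 + x) ^ (1 + p - (k : ℝ))| ≤ (1 + x₁) ^ (1 + r - (k : ℝ)) := by
    intro p hp
    rw [abs_of_nonneg (Real.rpow_nonneg (by linarith) _)]
    exact rpow_le_rpow_of_base_le_of_exponent_ge (by linarith) (by linarith) (by linarith)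
      (by linarith) (by linarith) (by linarith)
  rw [iteratedDeriv_id_add_mul_one_add_rpow b (1 + ℓ) x k (by linarith),
    iteratedDeriv_id_add_mul_one_add_rpow bt (1 + lt) x k (by linarith),
    add_sub_add_left_eq_sub, ← mul_assoc, ← mul_assoc]
  calc _ ≤ |b * (descPochhammer ℝ k).eval (1 + ℓ)| * |(1 + x) ^ (1 + ℓ - (k : ℝ))| +
        |bt * (descPochhammer ℝ k).eval (1 + lt)| * |(1 + x) ^ (1 + lt - (k : ℝ))| := by
        rw [← abs_mul, ← abs_mul]
        exact abs_sub _ _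
    _ ≤ c k * (1 + x₁) ^ (1 + r - (k : ℝ)) := by
        rw [add_mul]
        gcongr
        · exact hbound ℓ hrℓ
        · exact hbound lt hrlt
    _ ≤ _ := mul_le_mul_of_nonneg_right hck (Real.rpow_nonneg (by linarith) _)
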